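/- Let L be a Heyting algebra with finite connected decompositions, let (A, B) be a finite duality in L with B nonempty, and let M be a transversal of A. Then every element m ∈ M is a left dual, i.e., there exists r_m ∈ L such that (m, r_m) is a duality pair. -/

import Mathlib

open Set

/-- `upSet M = {x | ∃ m ∈ M, m ≤ x}`. -/
def upSet {L : Type*} [Preorder L] (M : Set L) : Set L := {x | ∃ m ∈ M, m ≤ x}

/-- `downSet M = {x | ∃ m ∈ M, x ≤ m}`. -/
def downSet {L : Type*} [Preorder L] (M : Set L) : Set L := {x | ∃ m ∈ M, x ≤ m}

/-- A finite duality `(A, B)`: finite antichains such that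
`x ∈ ↑A` iff `x ∉ ↓B`. -/
def FiniteDuality {L : Type*} [Preorder L] (A B : Set L) : Prop :=
  A.Finite ∧ B.Finite ∧ IsAntichain (· ≤ ·) A ∧ IsAntichain (· ≤ ·) B ∧
    ∀ x : L, (∃ a ∈ A, a ≤ x) ↔ ¬ ∃ b ∈ B, x ≤ b

/-- `(l, r)` is a duality pair if `¬ l ≤ x ↔ x ≤ r` for all `x`. -/
def DualityPair {L : Type*} [Preorder L] (l r : L) : Prop :=
  ∀ x : L, ¬ l ≤ x ↔ x ≤ r

/-- An element is connected (join-prime) if `a ≤ b ⊔ c` implies `a ≤ b` or `a ≤ c`. -/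
def ConnectedElt {L : Type*} [SemilatticeSup L] (a : L) : Prop :=
  ∀ b c : L, a ≤ b ⊔ c → a ≤ b ∨ a ≤ c

/-- `L` has finite connected decompositions: every element is the supremum of a
finite nonempty set of connected elements. -/
def HasFiniteConnectedDecompositions (L : Type*) [SemilatticeSup L] : Prop :=
  ∀ a : L, ∃ (F : Finset L) (h : F.Nonempty),
    (∀ c ∈ F, ConnectedElt c) ∧ F.sup' h id = a

/-- `c` is a connected component of `a`: `c` is connected and either `c = a` or
there is `b` with `a = b ⊔ c ≠ b`. -/
def IsConnComponent {L : Type*} [SemilatticeSup L] (c a : L) : Prop :=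
  ConnectedElt c ∧ (c = a ∨ ∃ b : L, a = b ⊔ c ∧ b ⊔ c ≠ b)

/-- `connComponents A` is the set of connected components of elements of `A`. -/
def connComponents {L : Type*} [SemilatticeSup L] (A : Set L) : Set L :=
  {c | ∃ a ∈ A, IsConnComponent c a}

/-- A quasitransversal of `A`: an antichain `M ⊆ A_Cn` with `A ⊆ ↑M`. -/
def IsQuasitransversal {L : Type*} [SemilatticeSup L] (M A : Set L) : Prop :=
  M ⊆ connComponents A ∧ IsAntichain (· ≤ ·) M ∧ A ⊆ upSet M

/-- A transversal of `A`: a quasitransversal maximal in the refinement order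
`M ⊴ N ↔ N ⊆ ↑M`. -/
def IsTransversal {L : Type*} [SemilatticeSup L] (M A : Set L) : Prop :=
  IsQuasitransversal M A ∧
    ∀ N : Set L, IsQuasitransversal N A → N ⊆ upSet M → N = M

/-- The set of weak left duals: elements of `A` for some finite duality `(A, B)`
with `B` nonempty. -/
def wld (L : Type*) [Preorder L] : Set L :=
  {a | ∃ A B : Set L, FiniteDuality A B ∧ B.Nonempty ∧ a ∈ A}

/-- The sparse incomparability axiom. -/
def SIA (L : Type*) [Preorder L] : Prop :=
  ∀ (x : L) (M U : Set L), M.Finite → U.Finite →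
    (insert x (upSet U)) ∩ wld L = ∅ →
    ∃ y : L, y ∉ wld L ∧ y ≤ x ∧ y ∉ upSet (insert x U) ∧
      ∀ m ∈ M, (y ≤ m ↔ x ≤ m)

section

variable {L : Type*}

theorem IsConnComponent.le [SemilatticeSup L] {c a : L} (h : IsConnComponent c a) : c ≤ a := by
  obtain ⟨-, rfl | ⟨b, rfl, -⟩⟩ := h
  · exact le_rfl
  · exact le_sup_right

theorem IsConnComponent.ne_bot [SemilatticeSup L] [OrderBot L] {c a : L}
    (h : IsConnComponent c a) (ha : a ≠ ⊥) : c ≠ ⊥ := by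
  rintro rfl
  obtain ⟨-, rfl | ⟨b, -, hb⟩⟩ := h
  · exact ha rfl
  · exact hb (sup_bot_eq b)

theorem ConnectedElt.supPrime [SemilatticeSup L] [OrderBot L] {c : L}
    (h : ConnectedElt c) (hc : c ≠ ⊥) : SupPrime c :=
  ⟨fun hmin => hc hmin.eq_bot, fun {b d} => h b d⟩

theorem IsConnComponent.supPrime [SemilatticeSup L] [OrderBot L] {c a : L}
    (h : IsConnComponent c a) (ha : a ≠ ⊥) : SupPrime c :=
  h.1.supPrime (h.ne_bot ha)

/-- Every finite decomposition of `a ≠ ⊥` contains all connected components of `a`. -/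
theorem IsConnComponent.mem_of_sup_eq [SemilatticeSup L] [OrderBot L] {c a : L} {F : Finset L}
    (h : IsConnComponent c a) (ha : a ≠ ⊥) (hF : ∀ d ∈ F, ConnectedElt d)
    (hsup : F.sup id = a) : c ∈ F := by
  obtain ⟨f, hf, hcf⟩ := (h.supPrime ha).le_finset_sup.1 (h.le.trans_eq hsup.symm)
  have hfa : f ≤ a := hsup ▸ Finset.le_sup (f := id) hf
  suffices hfc : f ≤ c from le_antisymm hcf hfc ▸ hf
  obtain ⟨-, rfl | ⟨b, rfl, hb⟩⟩ := h
  · exact hfa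
  · exact (hF f hf b c hfa).resolve_left fun hfb => hb (sup_eq_left.2 (hcf.trans hfb))

/-- A join-prime maximal element of a finite set is a connected component of its
supremum. -/
theorem isConnComponent_of_maximal [SemilatticeSup L] [OrderBot L] {g : L} {F : Finset L}
    (hg : Maximal (· ∈ F) g) (hprime : SupPrime g) : IsConnComponent g (F.sup id) := by
  classical
  refine ⟨fun b c => @hprime.2 b c, Or.inr ⟨(F.erase g).sup id, ?_, fun heq => ?_⟩⟩
  · conv_lhs => rw [← Finset.insert_erase hg.prop]
    rw [Finset.sup_insert, sup_comm, id]
  · obtain ⟨f, hf, hgf⟩ := hprime.le_finset_sup.1 (sup_eq_left.1 heq)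
    obtain ⟨hne, hfF⟩ := Finset.mem_erase.1 hf
    exact hne (hg.eq_of_le hfF hgf).symm

theorem HasFiniteConnectedDecompositions.exists_sup_eq [SemilatticeSup L] [OrderBot L]
    (hL : HasFiniteConnectedDecompositions L) (a : L) :
    ∃ F : Finset L, (∀ c ∈ F, ConnectedElt c) ∧ F.sup id = a := by
  obtain ⟨F, hne, hF, hsup⟩ := hL a
  exact ⟨F, hF, by rw [← hsup, Finset.sup'_eq_sup]⟩

theorem HasFiniteConnectedDecompositions.finite_connComponents [SemilatticeSup L] [OrderBot L]
    (hL : HasFiniteConnectedDecompositions L) {A : Set L} (hA : A.Finite) (hbot : ⊥ ∉ A) :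
    (connComponents A).Finite := by
  choose F hF hsup using hL.exists_sup_eq
  refine (hA.biUnion fun a _ => (F a).finite_toSet).subset ?_
  rintro c ⟨a, ha, hc⟩
  exact mem_biUnion ha (hc.mem_of_sup_eq (ne_of_mem_of_not_mem ha hbot) (hF a) (hsup a))

theorem HasFiniteConnectedDecompositions.exists_isConnComponent_not_le [SemilatticeSup L]
    [OrderBot L] (hL : HasFiniteConnectedDecompositions L) {a x : L} (hax : ¬ a ≤ x) :
    ∃ c, IsConnComponent c a ∧ ¬ c ≤ x := by
  obtain ⟨F, hF, rfl⟩ := hL.exists_sup_eq a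
  obtain ⟨f, hf, hfx⟩ : ∃ f ∈ F, ¬ f ≤ x := by simpa using hax
  obtain ⟨g, hfg, hg⟩ := F.exists_le_maximal hf
  have hgx : ¬ g ≤ x := fun h => hfx (hfg.trans h)
  have hg0 : g ≠ ⊥ := by
    rintro rfl
    exact hgx bot_le
  exact ⟨g, isConnComponent_of_maximal hg ((hF g hg.prop).supPrime hg0), hgx⟩

/-- The minimal connected components of elements of `A` that are not below a given `x ∉ ↑A` form a
quasitransversal of `A`. -/
theorem HasFiniteConnectedDecompositions.isQuasitransversal_minimal [SemilatticeSup L] [OrderBot L]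
    (hL : HasFiniteConnectedDecompositions L) {A : Set L} (hA : A.Finite) (hbot : ⊥ ∉ A)
    {x : L} (hx : x ∉ upSet A) :
    IsQuasitransversal {c | Minimal (fun d => d ∈ connComponents A ∧ ¬ d ≤ x) c} A := by
  refine ⟨fun c hc => (mem_ofPred.1 hc).prop.1, setOfPred_minimal_antichain _, fun a ha => ?_⟩
  obtain ⟨c, hc, hcx⟩ := hL.exists_isConnComponent_not_le fun h => hx ⟨a, ha, h⟩
  have hfin : {d | d ∈ connComponents A ∧ ¬ d ≤ x}.Finite :=
    (hL.finite_connComponents hA hbot).subset fun d hd => hd.1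
  obtain ⟨m, hmc, hm⟩ := hfin.exists_le_minimal (a := c) ⟨⟨a, ha, hc⟩, hcx⟩
  exact ⟨m, hm, hmc.trans hc.le⟩

/-- If `M` consists of join-prime elements and the complement of `↑M` is covered by finitely many
principal ideals, then it is contained in one of them. -/
theorem exists_forall_not_mem_upSet_le [SemilatticeSup L] [OrderBot L] {M B : Set L}
    (hM : ∀ m ∈ M, SupPrime m) (hB : B.Finite) (hcover : ∀ x ∉ upSet M, ∃ b ∈ B, x ≤ b) :
    ∃ b ∈ B, ∀ x ∉ upSet M, x ≤ b := by
  by_contra! h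
  choose! f hf hfb using h
  obtain ⟨b, hb, hle⟩ := hcover (hB.toFinset.sup f) <| by
    rintro ⟨m, hm, hms⟩
    obtain ⟨b, hb, hmb⟩ := (hM m hm).le_finset_sup.1 hms
    exact hf b (hB.mem_toFinset.1 hb) ⟨m, hm, hmb⟩
  exact hfb b hb ((Finset.le_sup (hB.mem_toFinset.2 hb)).trans hle)

/-- If `b` is the greatest element of the complement of `↑M` for an antichain `M`, then every
`m ∈ M` has right dual `m ⇨ b`. -/
theorem dualityPair_himp [GeneralizedHeytingAlgebra L] {M : Set L} {b m : L}
    (hM : IsAntichain (· ≤ ·) M) (hb : ∀ x, x ∉ upSet M ↔ x ≤ b) (hm : m ∈ M) :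
    DualityPair m (m ⇨ b) := by
  intro x
  rw [le_himp_iff, ← hb, not_iff_not]
  constructor
  · exact fun hmx => ⟨m, hm, le_inf hmx le_rfl⟩
  · rintro ⟨n, hn, hnx⟩
    obtain ⟨hnx, hnm⟩ := le_inf_iff.1 hnx
    rwa [← hM.eq hn hm hnm]

end

/-- in a Heyting algebra with finite connected decompositions,
every element of a transversal of a finite duality is a left dual. -/
theorem transversal_elements_are_leftDuals {L : Type*} [HeytingAlgebra L]
    (hL : HasFiniteConnectedDecompositions L) (A B M : Set L)
    (hAB : FiniteDuality A B) (hB : B.Nonempty) (hM : IsTransversal M A) :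
    ∀ m ∈ M, ∃ r_m : L, DualityPair m r_m := by
  obtain ⟨hAfin, hBfin, -, -, hdual⟩ := hAB
  obtain ⟨⟨hMA, hManti, hAM⟩, hmax⟩ := hM
  have hbot : ⊥ ∉ A := fun h =>
    (hdual ⊥).1 ⟨⊥, h, le_rfl⟩ (hB.imp fun b hb => ⟨hb, bot_le⟩)
  have hprime : ∀ m ∈ M, SupPrime m := fun m hm => by
    obtain ⟨a, ha, hma⟩ := hMA hm
    exact hma.supPrime (ne_of_mem_of_not_mem ha hbot)
  have hcover : ∀ x ∉ upSet M, ∃ b ∈ B, x ≤ b := fun x hx => by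
    by_contra h
    obtain ⟨a, ha, hax⟩ := (hdual x).2 h
    obtain ⟨m, hm, hma⟩ := hAM ha
    exact hx ⟨m, hm, hma.trans hax⟩
  obtain ⟨b, hb, hle⟩ := exists_forall_not_mem_upSet_le hprime hBfin hcover
  have hbA : b ∉ upSet A := fun h => (hdual b).1 h ⟨b, hb, le_rfl⟩
  have hMb := hmax _ (hL.isQuasitransversal_minimal hAfin hbot hbA) fun c hc =>
    not_not.1 fun hcM => (mem_ofPred.1 hc).prop.2 (hle c hcM)
  refine fun m hm => ⟨m ⇨ b, dualityPair_himp hManti (fun x => ⟨hle x, ?_⟩) hm⟩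
  rintro hxb ⟨n, hn, hnx⟩
  rw [← hMb, mem_ofPred] at hn
  exact hn.prop.2 (hnx.trans hxb)
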